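/- Theorem 2: with the weight sequences s_0 = 1, s_k = (-1)^k·(1-t) for k ≥ 1, and t_k = t for all k (in ℤ[t]), the Jacobi-type array satisfies a(n,0) = c_n(t) for all n ≥ 0; i.e., the generating function Σ_{n≥0} c_n(t) z^n has the Jacobi continued fraction expansion with s_0 = 1, s_n = (-1)^n(1-t) for n > 0, and t_n = t. -/

import Mathlib

open Polynomial Finset

/-- The Jacobi-type array: `a 0 k = [k = 0]`, and
`a (n+1) k = a n (k-1) + s k * a n k + t k * a n (k+1)` with `a n (-1) = 0`. -/
def jacobiA {R : Type*} [CommRing R] (s t : ℕ → R) : ℕ → ℕ → R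
  | 0, k => if k = 0 then 1 else 0
  | n+1, k =>
      (if k = 0 then 0 else jacobiA s t n (k-1)) + s k * jacobiA s t n k
        + t k * jacobiA s t n (k+1)

/-- The Narayana polynomial `C_n(t) ∈ ℤ[t]`:
`C_0(t) = 1` and `C_n(t) = ∑_{k=0}^{n-1} (1/(k+1))·binom(n,k)·binom(n-1,k)·t^k` for `n ≥ 1`. -/
noncomputable def narayana (n : ℕ) : Polynomial ℤ :=
  if n = 0 then 1 else
    ∑ k ∈ Finset.range n,
      Polynomial.C ((n.choose k * (n-1).choose k / (k+1) : ℕ) : ℤ) * Polynomial.X ^ k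

/-- The polynomial `c_n(t) = C_n(t;-1) ∈ ℤ[t]`: `c_0(t) = 1` and
`c_n(t) = ∑_{k=0}^{n} binom(⌊(n-1)/2⌋,⌊k/2⌋)·binom(⌊n/2⌋,⌊(k+1)/2⌋)·t^k` for `n ≥ 1`. -/
noncomputable def cnar (n : ℕ) : Polynomial ℤ :=
  if n = 0 then 1 else
    ∑ k ∈ Finset.range (n+1),
      Polynomial.C ((((n-1)/2).choose (k/2) * (n/2).choose ((k+1)/2) : ℕ) : ℤ) * Polynomial.X ^ k


section

variable {R : Type*} [CommRing R]

/-- The polynomial `∑ i, binom(a, i) · binom(b, i + j) · y ^ i` evaluated at `y : R`. -/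
def chooseSum (y : R) (a b j : ℕ) : R :=
  ∑ i ∈ range (a + 1), (a.choose i * b.choose (i + j) : ℕ) * y ^ i

theorem chooseSum_succ_left (y : R) (a b j : ℕ) :
    chooseSum y (a + 1) b j = chooseSum y a b j + y * chooseSum y a b (j + 1) := by
  have h : chooseSum y a b j =
      ∑ i ∈ range (a + 1 + 1), (a.choose i * b.choose (i + j) : ℕ) * y ^ i := by
    rw [sum_range_succ]
    simp [chooseSum]
  rw [h, chooseSum, chooseSum, sum_range_succ', sum_range_succ' _ (a + 1), mul_sum,
    add_right_comm, ← sum_add_distrib]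
  congr 1
  · refine sum_congr rfl fun i _ => ?_
    rw [Nat.choose_succ_succ', show i + 1 + j = i + (j + 1) by lia]
    push_cast
    ring
  · simp

theorem chooseSum_succ_right (y : R) (a b j : ℕ) :
    chooseSum y a (b + 1) (j + 1) = chooseSum y a b j + chooseSum y a b (j + 1) := by
  simp only [chooseSum, ← sum_add_distrib]
  refine sum_congr rfl fun i _ => ?_
  rw [← add_assoc, Nat.choose_succ_succ']
  push_cast
  ring

theorem chooseSum_succ_right_zero (y : R) (m : ℕ) :
    chooseSum y m (m + 1) 0 = chooseSum y m m 0 + y * chooseSum y m m 1 := by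
  rw [← chooseSum_succ_left, chooseSum, chooseSum, sum_range_succ _ (m + 1)]
  simp [mul_comm]

/-- The polynomial `∑ k, binom(a, ⌊k/2⌋) · binom(b, ⌊(k+1)/2⌋ + j) · x ^ k` evaluated at
`x : R`. -/
def halfChooseSum (x : R) (a b j : ℕ) : R :=
  chooseSum (x ^ 2) a b j + x * chooseSum (x ^ 2) a b (j + 1)

theorem halfChooseSum_succ_left (x : R) (a b j : ℕ) :
    halfChooseSum x (a + 1) b j =
      halfChooseSum x a b j + x ^ 2 * halfChooseSum x a b (j + 1) := by
  simp only [halfChooseSum, chooseSum_succ_left]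
  ring

theorem halfChooseSum_succ_right (x : R) (a b j : ℕ) :
    halfChooseSum x a (b + 1) (j + 1) =
      halfChooseSum x a b j + halfChooseSum x a b (j + 1) := by
  simp only [halfChooseSum, chooseSum_succ_right]
  ring

theorem halfChooseSum_succ_right_zero (x : R) (m : ℕ) :
    halfChooseSum x m (m + 1) 0 = (1 + x) * halfChooseSum x m m 0 := by
  simp only [halfChooseSum, chooseSum_succ_right, chooseSum_succ_right_zero]
  ring

theorem sum_range_two_mul (f : ℕ → R) (n : ℕ) :
    ∑ k ∈ range (2 * n), f k = ∑ i ∈ range n, (f (2 * i) + f (2 * i + 1)) := by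
  induction n with
  | zero => simp
  | succ n ih =>
    rw [mul_add_one, sum_range_succ, sum_range_succ, sum_range_succ, ih]
    ring

theorem halfChooseSum_zero_eq_sum (x : R) (a b : ℕ) :
    halfChooseSum x a b 0 =
      ∑ k ∈ range (2 * (a + 1)), (a.choose (k / 2) * b.choose ((k + 1) / 2) : ℕ) * x ^ k := by
  rw [sum_range_two_mul, halfChooseSum, chooseSum, chooseSum, mul_sum, ← sum_add_distrib]
  refine sum_congr rfl fun i _ => ?_
  rw [show 2 * i / 2 = i by lia, show (2 * i + 1) / 2 = i by lia,
    show (2 * i + 1 + 1) / 2 = i + 1 by lia]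
  push_cast
  ring_nf

/-- The diagonal weights `1, -(1 - x), 1 - x, -(1 - x), …`. -/
def altWeight (x : R) (k : ℕ) : R :=
  if k = 0 then 1 else (-1) ^ k * (1 - x)

theorem altWeight_zero (x : R) : altWeight x 0 = 1 := rfl

theorem altWeight_odd (x : R) (j : ℕ) : altWeight x (2 * j + 1) = -(1 - x) := by
  simp [altWeight, pow_succ, pow_mul]

theorem altWeight_even (x : R) (j : ℕ) : altWeight x (2 * j + 2) = 1 - x := by
  simp [altWeight, pow_succ, pow_mul]

theorem jacobiA_succ_zero (s t : ℕ → R) (n : ℕ) :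
    jacobiA s t (n + 1) 0 = s 0 * jacobiA s t n 0 + t 0 * jacobiA s t n 1 := by
  simp [jacobiA]

theorem jacobiA_succ_succ (s t : ℕ → R) (n k : ℕ) :
    jacobiA s t (n + 1) (k + 1) =
      jacobiA s t n k + s (k + 1) * jacobiA s t n (k + 1) + t (k + 1) * jacobiA s t n (k + 2) := by
  simp [jacobiA]

/-- If a row pairs up as `g j` at `2j` and `x * g (j + 1)` at `2j + 1`, then the next row is
constant on each pair of positions `2j`, `2j + 1`. -/
theorem jacobiA_altWeight_succ_of_even (x : R) (n : ℕ) (g : ℕ → R)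
    (h₀ : ∀ j, jacobiA (altWeight x) (fun _ => x) n (2 * j) = g j)
    (h₁ : ∀ j, jacobiA (altWeight x) (fun _ => x) n (2 * j + 1) = x * g (j + 1)) (j : ℕ) :
    jacobiA (altWeight x) (fun _ => x) (n + 1) (2 * j) = g j + x ^ 2 * g (j + 1) ∧
      jacobiA (altWeight x) (fun _ => x) (n + 1) (2 * j + 1) = g j + x ^ 2 * g (j + 1) := by
  constructor
  · cases j with
    | zero =>
      rw [mul_zero, jacobiA_succ_zero, altWeight_zero, h₀ 0, h₁ 0]
      ring
    | succ j =>
      rw [mul_add_one, jacobiA_succ_succ, altWeight_even, h₁,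
        show 2 * j + 1 + 1 = 2 * (j + 1) by rfl, h₀,
        show 2 * j + 1 + 2 = 2 * (j + 1) + 1 by rfl, h₁]
      ring
  · rw [jacobiA_succ_succ, altWeight_odd, h₀, h₁, ← mul_add_one, h₀]
    ring

/-- If a row equals `g j` at `2j` and at `2j + 1`, then the next row pairs up as
`g j + g (j + 1)` at `2j + 2` and `x` times this at `2j + 1`. -/
theorem jacobiA_altWeight_succ_of_odd (x : R) (n : ℕ) (g : ℕ → R)
    (h : ∀ j, jacobiA (altWeight x) (fun _ => x) n (2 * j) = g j ∧
      jacobiA (altWeight x) (fun _ => x) n (2 * j + 1) = g j) :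
    jacobiA (altWeight x) (fun _ => x) (n + 1) 0 = (1 + x) * g 0 ∧
      (∀ j, jacobiA (altWeight x) (fun _ => x) (n + 1) (2 * j + 1) = x * (g j + g (j + 1))) ∧
      ∀ j, jacobiA (altWeight x) (fun _ => x) (n + 1) (2 * (j + 1)) = g j + g (j + 1) := by
  refine ⟨?_, fun j => ?_, fun j => ?_⟩
  · have h₀ := h 0
    rw [mul_zero, zero_add] at h₀
    rw [jacobiA_succ_zero, altWeight_zero, h₀.1, h₀.2]
    ring
  · rw [jacobiA_succ_succ, altWeight_odd, (h j).1, (h j).2, ← mul_add_one, (h (j + 1)).1]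
    ring
  · rw [mul_add_one, jacobiA_succ_succ, altWeight_even, (h j).2,
      show 2 * j + 1 + 1 = 2 * (j + 1) by rfl, (h (j + 1)).1,
      show 2 * j + 1 + 2 = 2 * (j + 1) + 1 by rfl, (h (j + 1)).2]
    ring

theorem jacobiA_altWeight_even_of_odd (x : R) (m : ℕ)
    (h : ∀ j, jacobiA (altWeight x) (fun _ => x) (2 * m + 1) (2 * j) = halfChooseSum x m m j ∧
      jacobiA (altWeight x) (fun _ => x) (2 * m + 1) (2 * j + 1) = halfChooseSum x m m j) (j : ℕ) :
    jacobiA (altWeight x) (fun _ => x) (2 * m + 2) (2 * j) = halfChooseSum x m (m + 1) j ∧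
      jacobiA (altWeight x) (fun _ => x) (2 * m + 2) (2 * j + 1) =
        x * halfChooseSum x m (m + 1) (j + 1) := by
  obtain ⟨h₀, h₁, h₂⟩ := jacobiA_altWeight_succ_of_odd x _ _ h
  refine ⟨?_, by rw [h₁, halfChooseSum_succ_right]⟩
  cases j with
  | zero => rw [mul_zero, h₀, halfChooseSum_succ_right_zero]
  | succ j => rw [h₂, halfChooseSum_succ_right]

theorem jacobiA_altWeight_odd (x : R) (m j : ℕ) :
    jacobiA (altWeight x) (fun _ => x) (2 * m + 1) (2 * j) = halfChooseSum x m m j ∧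
      jacobiA (altWeight x) (fun _ => x) (2 * m + 1) (2 * j + 1) = halfChooseSum x m m j := by
  induction m generalizing j with
  | zero => cases j <;> simp [jacobiA, halfChooseSum, chooseSum, altWeight, mul_add_one]
  | succ m ih =>
    have h := jacobiA_altWeight_even_of_odd x m ih
    rw [halfChooseSum_succ_left]
    exact jacobiA_altWeight_succ_of_even x _ _ (fun j => (h j).1) (fun j => (h j).2) j

end

theorem cnar_odd (m : ℕ) : cnar (2 * m + 1) = halfChooseSum X m m 0 := by
  rw [halfChooseSum_zero_eq_sum, cnar, if_neg (by lia)]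
  refine sum_congr rfl fun k _ => ?_
  rw [show (2 * m + 1 - 1) / 2 = m by lia, show (2 * m + 1) / 2 = m by lia]
  simp

theorem cnar_even (m : ℕ) : cnar (2 * m + 2) = halfChooseSum X m (m + 1) 0 := by
  rw [halfChooseSum_zero_eq_sum, cnar, if_neg (by lia), sum_range_succ,
    show (2 * m + 2 - 1) / 2 = m by lia, show (2 * m + 2) / 2 = m + 1 by lia,
    Nat.choose_succ_self]
  simp [mul_add_one]

/-- Theorem 2: with weights `s_0 = 1`, `s_k = (-1)^k (1-t)` for `k ≥ 1`, `t_k = t`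
in `ℤ[t]`, the Jacobi-type array satisfies `a(n,0) = c_n(t)`. -/
theorem jacobi_cnar (n : ℕ) :
    jacobiA (fun k => if k = 0 then 1 else (-1 : Polynomial ℤ) ^ k * (1 - Polynomial.X))
        (fun _ => Polynomial.X) n 0 = cnar n := by
  change jacobiA (altWeight X) (fun _ => X) n 0 = cnar n
  obtain ⟨m, rfl | rfl⟩ := n.even_or_odd'
  · cases m with
    | zero => simp [jacobiA, cnar]
    | succ m =>
      rw [mul_add_one, cnar_even]
      exact (jacobiA_altWeight_even_of_odd X m (jacobiA_altWeight_odd X m) 0).1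
  · rw [cnar_odd]
    exact (jacobiA_altWeight_odd X m 0).1
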